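/- arXiv:2010.07423 — 2 statements merged into one kernel-verified Lean document; each statement's English description precedes it below -/
import Mathlib

section
/- Let S be a nonempty finite set, let P be a probability distribution on S^4 satisfying the constraints C_L and C_M, and let N, M ≥ 3 be integers. Then the Shannon entropy of the explicitly constructed probability distribution Q_{N,M} equals (N−1)(M−1)·H(P) + (N−2)(M−2)·H(P_a) − (N−2)(M−1)·H(P_{ac}) − (N−1)(M−2)·H(P_{ab}). -/
open Finset

/-- A probability distribution on a finite type: nonnegative and sums to 1. -/
def IsProbDist {α : Type*} [Fintype α] (Q : α → ℝ) : Prop :=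
  (∀ x, 0 ≤ Q x) ∧ ∑ x, Q x = 1

/-- Shannon entropy of a finitely supported distribution. -/
noncomputable def entropy {α : Type*} [Fintype α] (Q : α → ℝ) : ℝ :=
  -∑ x, Q x * Real.log (Q x)

section Marginals

variable {S : Type*} [Fintype S]

/-- Marginal on the bottom pair (a, b). -/
def margAB (P : S × S × S × S → ℝ) : S × S → ℝ :=
  fun p => ∑ z : S, ∑ w : S, P (p.1, p.2, z, w)

/-- Marginal on the top pair (c, d). -/
def margCD (P : S × S × S × S → ℝ) : S × S → ℝ :=
  fun p => ∑ x : S, ∑ y : S, P (x, y, p.1, p.2)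

/-- Marginal on the left vertical pair (a, c). -/
def margAC (P : S × S × S × S → ℝ) : S × S → ℝ :=
  fun p => ∑ y : S, ∑ w : S, P (p.1, y, p.2, w)

/-- Marginal on the right vertical pair (b, d). -/
def margBD (P : S × S × S × S → ℝ) : S × S → ℝ :=
  fun p => ∑ x : S, ∑ z : S, P (x, p.1, z, p.2)

/-- Marginal on the single site a. -/
def margA (P : S × S × S × S → ℝ) : S → ℝ :=
  fun a => ∑ y : S, ∑ z : S, ∑ w : S, P (a, y, z, w)

/-- Marginal on the single site b. -/
def margB (P : S × S × S × S → ℝ) : S → ℝ :=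
  fun b => ∑ x : S, ∑ z : S, ∑ w : S, P (x, b, z, w)

/-- Marginal on the single site c. -/
def margC (P : S × S × S × S → ℝ) : S → ℝ :=
  fun c => ∑ x : S, ∑ y : S, ∑ w : S, P (x, y, c, w)

/-- Marginal on the single site d. -/
def margD (P : S × S × S × S → ℝ) : S → ℝ :=
  fun d => ∑ x : S, ∑ y : S, ∑ z : S, P (x, y, z, d)

/-- Marginal on the triple (a, b, d). -/
def margABD (P : S × S × S × S → ℝ) : S × S × S → ℝ :=
  fun p => ∑ z : S, P (p.1, p.2.1, z, p.2.2)

/-- Marginal on the triple (a, c, d). -/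
def margACD (P : S × S × S × S → ℝ) : S × S × S → ℝ :=
  fun p => ∑ y : S, P (p.1, y, p.2.1, p.2.2)

/-- The linear (translation-invariance) constraints `C_L`. -/
def CL (P : S × S × S × S → ℝ) : Prop :=
  margAB P = margCD P ∧ margAC P = margBD P

/-- The Markovian constraints `C_M`. -/
def CM (P : S × S × S × S → ℝ) : Prop :=
  entropy (margAC P) + entropy (margAB P) - entropy (margA P) - entropy (margABD P) = 0 ∧
  entropy (margAC P) + entropy (margAB P) - entropy (margA P) - entropy (margACD P) = 0

end Marginals

section Grid

variable {S : Type*} [Fintype S] [DecidableEq S]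

/-- The 2×2 cluster of a configuration whose bottom-left corner is at
(0-indexed) position `(i, j)`: (bottom-left, bottom-right, top-left, top-right). -/
def cluster {N M : ℕ} (ω : Fin N × Fin M → S) (i : Fin (N - 1)) (j : Fin (M - 1)) :
    S × S × S × S :=
  (ω (⟨i.1, by have := i.isLt; omega⟩, ⟨j.1, by have := j.isLt; omega⟩),
   ω (⟨i.1 + 1, by have := i.isLt; omega⟩, ⟨j.1, by have := j.isLt; omega⟩),
   ω (⟨i.1, by have := i.isLt; omega⟩, ⟨j.1 + 1, by have := j.isLt; omega⟩),
   ω (⟨i.1 + 1, by have := i.isLt; omega⟩, ⟨j.1 + 1, by have := j.isLt; omega⟩))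

/-- The pushforward (marginal) of a distribution on configurations under the map
sending a configuration to its 2×2 cluster at position `(i, j)`. -/
def marginalAt {N M : ℕ} (Q : (Fin N × Fin M → S) → ℝ)
    (i : Fin (N - 1)) (j : Fin (M - 1)) : S × S × S × S → ℝ :=
  fun p => ∑ ω : Fin N × Fin M → S, if cluster ω i j = p then Q ω else 0

/-- A distribution `Q` on `N × M` configurations is consistent with `P` if every 2×2
cluster marginal of `Q` equals `P`. -/
def Consistent {N M : ℕ} (Q : (Fin N × Fin M → S) → ℝ) (P : S × S × S × S → ℝ) : Prop :=
  ∀ (i : Fin (N - 1)) (j : Fin (M - 1)), marginalAt Q i j = P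

end Grid
section Ansatz

variable {S : Type*} [Fintype S] [DecidableEq S]

/-- Numerator of the ansatz distribution `Q_{N,M}`. -/
noncomputable def QNMnum (P : S × S × S × S → ℝ) (N M : ℕ) (ω : Fin N × Fin M → S) : ℝ :=
  (∏ i : Fin (N - 1), ∏ j : Fin (M - 1), P (cluster ω i j)) *
  ∏ i : Fin (N - 2), ∏ j : Fin (M - 2),
    margA P (ω (⟨i.1 + 1, by have := i.isLt; omega⟩, ⟨j.1 + 1, by have := j.isLt; omega⟩))

/-- Denominator of the ansatz distribution `Q_{N,M}`. -/
noncomputable def QNMden (P : S × S × S × S → ℝ) (N M : ℕ) (ω : Fin N × Fin M → S) : ℝ :=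
  (∏ i : Fin (N - 2), ∏ j : Fin (M - 1),
    margAC P (ω (⟨i.1 + 1, by have := i.isLt; omega⟩, ⟨j.1, by have := j.isLt; omega⟩),
              ω (⟨i.1 + 1, by have := i.isLt; omega⟩, ⟨j.1 + 1, by have := j.isLt; omega⟩))) *
  ∏ i : Fin (N - 1), ∏ j : Fin (M - 2),
    margAB P (ω (⟨i.1, by have := i.isLt; omega⟩, ⟨j.1 + 1, by have := j.isLt; omega⟩),
              ω (⟨i.1 + 1, by have := i.isLt; omega⟩, ⟨j.1 + 1, by have := j.isLt; omega⟩))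

open Classical in
/-- The explicitly constructed ansatz distribution `Q_{N,M}`, with the convention that it
vanishes whenever its numerator vanishes. -/
noncomputable def QNM (P : S × S × S × S → ℝ) (N M : ℕ) : (Fin N × Fin M → S) → ℝ :=
  fun ω => if QNMnum P N M ω = 0 then 0 else QNMnum P N M ω / QNMden P N M ω

/-- Numerator of the snake distribution. -/
noncomputable def snakeNum (P : S × S × S × S → ℝ) (N : ℕ) (x : Fin N × Fin 2 → S) : ℝ :=
  ∏ i : Fin (N - 1),
    P (x (⟨i.1, by have := i.isLt; omega⟩, 0), x (⟨i.1 + 1, by have := i.isLt; omega⟩, 0),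
       x (⟨i.1, by have := i.isLt; omega⟩, 1), x (⟨i.1 + 1, by have := i.isLt; omega⟩, 1))

/-- Denominator of the snake distribution. -/
noncomputable def snakeDen (P : S × S × S × S → ℝ) (N : ℕ) (x : Fin N × Fin 2 → S) : ℝ :=
  ∏ i : Fin (N - 2),
    margAC P (x (⟨i.1 + 1, by have := i.isLt; omega⟩, 0),
              x (⟨i.1 + 1, by have := i.isLt; omega⟩, 1))

open Classical in
/-- The snake distribution on two-row configurations, with the convention that it vanishes
whenever its numerator vanishes. -/
noncomputable def Snake (P : S × S × S × S → ℝ) (N : ℕ) : (Fin N × Fin 2 → S) → ℝ :=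
  fun x => if snakeNum P N x = 0 then 0 else snakeNum P N x / snakeDen P N x

end Ansatz

/-- Unnormalised path weight of a chain with edge weights `K` and vertex weights `r`: the product
of `K` over consecutive pairs divided by the product of `r` over interior sites. -/
noncomputable def chainWeight {α : Type*} (K : α × α → ℝ) (r : α → ℝ) (n : ℕ)
    (x : Fin (n + 2) → α) : ℝ :=
  (∏ i : Fin (n + 1), K (x i.castSucc, x i.succ)) / ∏ i : Fin n, r (x i.succ.castSucc)

section Chain

variable {α β γ : Type*}

theorem chainWeight_zero (K : α × α → ℝ) (r : α → ℝ) (x : Fin 2 → α) :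
    chainWeight K r 0 x = K (x 0, x 1) := by
  simp [chainWeight]

theorem chainWeight_cons (K : α × α → ℝ) (r : α → ℝ) (n : ℕ) (a : α) (x : Fin (n + 2) → α) :
    chainWeight K r (n + 1) (Fin.cons a x : Fin (n + 3) → α) =
      K (a, x 0) / r (x 0) * chainWeight K r n x := by
  unfold chainWeight
  rw [Fin.prod_univ_succ, Fin.prod_univ_succ (n := n) (fun i => r _)]
  simp only [Fin.castSucc_zero, Fin.castSucc_succ, Fin.cons_zero, Fin.cons_succ]
  rw [mul_div_mul_comm]

theorem chainWeight_nonneg {K : α × α → ℝ} {r : α → ℝ} (hK : ∀ p, 0 ≤ K p) (hr : ∀ x, 0 ≤ r x)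
    (n : ℕ) (x : Fin (n + 2) → α) : 0 ≤ chainWeight K r n x :=
  div_nonneg (prod_nonneg fun _ _ => hK _) (prod_nonneg fun _ _ => hr _)

theorem chainWeight_eq_zero_of_first {K : α × α → ℝ} {r : α → ℝ} {n : ℕ} {x : Fin (n + 2) → α}
    (h : ∀ y, K (x 0, y) = 0) : chainWeight K r n x = 0 := by
  unfold chainWeight
  rw [prod_eq_zero (mem_univ 0) (by simpa using h _), zero_div]

theorem chainWeight_comp_rev (K : α × α → ℝ) (r : α → ℝ) (n : ℕ) (x : Fin (n + 2) → α) :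
    chainWeight K r n (x ∘ Fin.rev) = chainWeight (fun p => K (p.2, p.1)) r n x := by
  unfold chainWeight
  congr 1
  · rw [← Equiv.prod_comp Fin.revPerm]
    simp [Fin.rev_castSucc, Fin.rev_succ]
  · rw [← Equiv.prod_comp Fin.revPerm]
    simp [Fin.rev_castSucc, Fin.rev_succ]

variable [Fintype α] [Fintype β] [Fintype γ]

theorem entropy_comp_equiv (e : α ≃ β) (Q : β → ℝ) : entropy (fun x => Q (e x)) = entropy Q := by
  unfold entropy
  rw [Equiv.sum_comp e fun y => Q y * Real.log (Q y)]

theorem sum_fin_cons {n : ℕ} (f : (Fin (n + 1) → α) → ℝ) :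
    ∑ x, f x = ∑ x : Fin n → α, ∑ a, f (Fin.cons a x) := by
  rw [← Equiv.sum_comp (Fin.consEquiv fun _ => α), Fintype.sum_prod_type_right]
  rfl

theorem sum_fin_two (f : (Fin 2 → α) → ℝ) : ∑ x, f x = ∑ a, ∑ b, f ![a, b] := by
  rw [← Equiv.sum_comp (finTwoArrowEquiv α).symm, Fintype.sum_prod_type]
  rfl

section Marginal

variable {K : α × α → ℝ} {r : α → ℝ}

theorem edge_eq_zero_of_right (hK : ∀ p, 0 ≤ K p) (hr : ∀ y, ∑ x, K (x, y) = r y) {y : α}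
    (hy : r y = 0) (x : α) : K (x, y) = 0 :=
  (sum_eq_zero_iff_of_nonneg fun _ _ => hK _).1 ((hr y).trans hy) x (mem_univ x)

theorem edge_eq_zero_of_left (hK : ∀ p, 0 ≤ K p) (hl : ∀ x, ∑ y, K (x, y) = r x) {x : α}
    (hx : r x = 0) (y : α) : K (x, y) = 0 :=
  (sum_eq_zero_iff_of_nonneg fun _ _ => hK _).1 ((hl x).trans hx) y (mem_univ y)

theorem sum_chainWeight_mul_first (hK : ∀ p, 0 ≤ K p) (hl : ∀ x, ∑ y, K (x, y) = r x)
    (hr : ∀ y, ∑ x, K (x, y) = r y) (n : ℕ) (g : α → ℝ) :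
    ∑ x, chainWeight K r n x * g (x 0) = ∑ a, r a * g a := by
  induction n generalizing g with
  | zero =>
    rw [sum_fin_two]
    simp [chainWeight_zero, ← sum_mul, hl]
  | succ n ih =>
    rw [sum_fin_cons]
    simp only [chainWeight_cons, Fin.cons_zero]
    have h := ih fun z => (∑ a, K (a, z) * g a) / r z
    calc _ = ∑ x, chainWeight K r n x * ((∑ a, K (a, x 0) * g a) / r (x 0)) := by
          refine sum_congr rfl fun x _ => ?_
          rw [sum_div, mul_sum]
          exact sum_congr rfl fun a _ => by ring
      _ = ∑ z, ∑ a, K (a, z) * g a := by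
          rw [h]
          refine sum_congr rfl fun z _ => ?_
          by_cases hz : r z = 0
          · simp [hz, edge_eq_zero_of_right hK hr hz]
          · field_simp
      _ = _ := by
          rw [sum_comm]
          simp [← sum_mul, hl]

theorem entropy_chainWeight (hK : ∀ p, 0 ≤ K p) (hl : ∀ x, ∑ y, K (x, y) = r x)
    (hr : ∀ y, ∑ x, K (x, y) = r y) (n : ℕ) :
    entropy (chainWeight K r n) = (n + 1) * entropy K - n * entropy r := by
  induction n with
  | zero =>
    unfold entropy
    rw [sum_fin_two, Fintype.sum_prod_type]
    simp [chainWeight_zero]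
  | succ n ih =>
    have hstep : ∀ x : Fin (n + 2) → α,
        ∑ a, chainWeight K r (n + 1) (Fin.cons a x : Fin (n + 3) → α) *
          Real.log (chainWeight K r (n + 1) (Fin.cons a x : Fin (n + 3) → α)) =
        chainWeight K r n x * Real.log (chainWeight K r n x) +
          chainWeight K r n x * ((∑ a, K (a, x 0) * (Real.log (K (a, x 0)) - Real.log (r (x 0))))
            / r (x 0)) := by
      intro x
      simp only [chainWeight_cons]
      by_cases hw : chainWeight K r n x = 0
      · simp [hw]
      have hx : r (x 0) ≠ 0 := fun h =>
        hw (chainWeight_eq_zero_of_first (edge_eq_zero_of_left hK hl h))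
      have hterm : ∀ a, K (a, x 0) / r (x 0) * chainWeight K r n x *
            Real.log (K (a, x 0) / r (x 0) * chainWeight K r n x) =
          K (a, x 0) * (chainWeight K r n x * Real.log (chainWeight K r n x) / r (x 0)) +
          chainWeight K r n x / r (x 0) *
            (K (a, x 0) * (Real.log (K (a, x 0)) - Real.log (r (x 0)))) := by
        intro a
        by_cases ha : K (a, x 0) = 0
        · simp [ha]
        rw [Real.log_mul (div_ne_zero ha hx) hw, Real.log_div ha hx]
        ring
      simp only [hterm, sum_add_distrib, ← sum_mul, ← mul_sum, hr]
      field_simp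
    have hsum : ∑ z, r z * ((∑ a, K (a, z) * (Real.log (K (a, z)) - Real.log (r z))) / r z) =
        entropy r - entropy K := by
      have hz : ∀ z, r z * ((∑ a, K (a, z) * (Real.log (K (a, z)) - Real.log (r z))) / r z) =
          ∑ a, K (a, z) * Real.log (K (a, z)) - r z * Real.log (r z) := by
        intro z
        by_cases hz : r z = 0
        · simp [hz, edge_eq_zero_of_right hK hr hz]
        · rw [mul_div_cancel₀ _ hz]
          simp only [mul_sub, sum_sub_distrib, ← sum_mul, hr]
      simp only [hz, sum_sub_distrib]
      unfold entropy
      rw [Fintype.sum_prod_type_right]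
      ring
    have htotal : entropy (chainWeight K r (n + 1)) =
        entropy (chainWeight K r n) - (entropy r - entropy K) := by
      rw [← hsum, ← sum_chainWeight_mul_first hK hl hr n]
      unfold entropy
      rw [sum_fin_cons]
      simp only [hstep, sum_add_distrib]
      ring
    rw [htotal, ih]
    push_cast
    ring

end Marginal

/-- Summing the second coordinates out of a chain on pairs, one site at a time from the first
site, yields a chain on the first coordinates. -/
theorem sum_chainWeight_snd {K : (β × γ) × (β × γ) → ℝ} {r : β × γ → ℝ} {k : β × β → ℝ}
    {ρ : β → ℝ} (hK : ∀ p, 0 ≤ K p) (hl : ∀ x, ∑ y, K (x, y) = r x)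
    (hk : ∀ a c, ∑ d, ∑ b, K ((a, b), (c, d)) = k (a, c))
    (hstep : ∀ a c d, ∑ b, K ((a, b), (c, d)) = k (a, c) * r (c, d) / ρ c)
    (n : ℕ) (u : Fin (n + 2) → β) :
    ∑ v : Fin (n + 2) → γ, chainWeight K r n (fun j => (u j, v j)) = chainWeight k ρ n u := by
  induction n with
  | zero =>
    rw [sum_fin_two, sum_comm]
    simp [chainWeight_zero, hk]
  | succ n ih =>
    obtain ⟨a, u, rfl⟩ : ∃ a u', u = (Fin.cons a u' : Fin (n + 3) → β) :=
      ⟨u 0, Fin.tail u, (Fin.cons_self_tail u).symm⟩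
    rw [sum_fin_cons, chainWeight_cons, ← ih, mul_sum]
    refine sum_congr rfl fun v _ => ?_
    have hcons : ∀ b, (fun j => ((Fin.cons a u : Fin (n + 3) → β) j,
        (Fin.cons b v : Fin (n + 3) → γ) j)) =
        (Fin.cons (a, b) (fun j => (u j, v j)) : Fin (n + 3) → β × γ) := by
      intro b
      funext j
      refine Fin.cases ?_ (fun i => ?_) j <;> simp
    simp only [hcons, chainWeight_cons]
    rw [← sum_mul, ← sum_div, hstep]
    by_cases h : r (u 0, v 0) = 0
    · rw [chainWeight_eq_zero_of_first (edge_eq_zero_of_left hK hl h)]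
      simp
    · field_simp

/-- Vanishing conditional mutual information forces conditional independence. -/
theorem mul_eq_mul_of_entropy_eq {p : α × β × γ → ℝ} {f : α × β → ℝ} {g : β × γ → ℝ} {h : β → ℝ}
    (hp : ∀ x, 0 ≤ p x) (hf : ∀ x y, ∑ z, p (x, y, z) = f (x, y))
    (hg : ∀ y z, ∑ x, p (x, y, z) = g (y, z)) (hfh : ∀ y, ∑ x, f (x, y) = h y)
    (hH : entropy g + entropy f - entropy h - entropy p = 0) (x : α) (y : β) (z : γ) :
    p (x, y, z) = f (x, y) * g (y, z) / h y := by
  have hf0 : ∀ q, 0 ≤ f q := fun ⟨x, y⟩ => hf x y ▸ sum_nonneg fun _ _ => hp _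
  have hg0 : ∀ q, 0 ≤ g q := fun ⟨y, z⟩ => hg y z ▸ sum_nonneg fun _ _ => hp _
  have hh0 : ∀ y, 0 ≤ h y := fun y => hfh y ▸ sum_nonneg fun _ _ => hf0 _
  have hgh : ∀ y, ∑ z, g (y, z) = h y := by
    intro y
    simp only [← hg, ← hfh, ← hf]
    exact sum_comm
  have hpf : ∀ x y z, p (x, y, z) ≤ f (x, y) := fun x y z =>
    hf x y ▸ single_le_sum (f := fun z => p (x, y, z)) (fun _ _ => hp _) (mem_univ z)
  have hpg : ∀ x y z, p (x, y, z) ≤ g (y, z) := fun x y z =>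
    hg y z ▸ single_le_sum (f := fun x => p (x, y, z)) (fun _ _ => hp _) (mem_univ x)
  have hfh' : ∀ x y, f (x, y) ≤ h y := fun x y =>
    hfh y ▸ single_le_sum (f := fun x => f (x, y)) (fun _ _ => hf0 _) (mem_univ x)
  set t : α → β → γ → ℝ := fun x y z =>
    f (x, y) * g (y, z) / h y - p (x, y, z) - p (x, y, z) *
      (Real.log (f (x, y)) + Real.log (g (y, z)) - Real.log (h y) - Real.log (p (x, y, z)))
    with ht
  have hkey : ∀ x y z, 0 ≤ t x y z ∧ (t x y z = 0 → p (x, y, z) = f (x, y) * g (y, z) / h y) := by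
    intro x y z
    rcases (hp (x, y, z)).eq_or_lt with h0 | h0
    · simp only [ht, ← h0, zero_mul, sub_zero]
      exact ⟨div_nonneg (mul_nonneg (hf0 _) (hg0 _)) (hh0 _), fun e => e.symm⟩
    have hfp := h0.trans_le (hpf x y z)
    have hgp := h0.trans_le (hpg x y z)
    have hhp := hfp.trans_le (hfh' x y)
    set q := f (x, y) * g (y, z) / h y with hq
    have hqp : 0 < q := by positivity
    have hlog : Real.log (f (x, y)) + Real.log (g (y, z)) - Real.log (h y)
        - Real.log (p (x, y, z)) = Real.log (q / p (x, y, z)) := by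
      rw [Real.log_div hqp.ne' h0.ne', hq, Real.log_div (by positivity) hhp.ne',
        Real.log_mul hfp.ne' hgp.ne']
    have hteq : t x y z = p (x, y, z) * (q / p (x, y, z) - 1 - Real.log (q / p (x, y, z))) := by
      simp only [ht]
      rw [hlog, ← hq]
      field_simp
    have hpos : 0 < q / p (x, y, z) := by positivity
    rw [hteq]
    refine ⟨mul_nonneg h0.le (by linarith [Real.log_le_sub_one_of_pos hpos]), fun e => ?_⟩
    by_contra hne
    have hne' : q / p (x, y, z) ≠ 1 := fun e' => hne ((div_eq_one_iff_eq h0.ne').1 e').symm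
    have := Real.log_lt_sub_one_of_pos hpos hne'
    rcases mul_eq_zero.1 e with e | e <;> linarith
  have hsum : ∑ x, ∑ y, ∑ z, t x y z = 0 := by
    have h1 : ∑ x, ∑ y, ∑ z, f (x, y) * g (y, z) / h y = ∑ y, h y := by
      rw [sum_comm]
      refine sum_congr rfl fun y _ => ?_
      simp only [← sum_div, ← mul_sum, ← sum_mul, hgh, hfh]
      exact mul_self_div_self _
    have h2 : ∑ x, ∑ y, ∑ z, p (x, y, z) = ∑ y, h y := by
      rw [sum_comm]
      simp only [hf, hfh]
    have h3 : ∑ x, ∑ y, ∑ z, p (x, y, z) * Real.log (f (x, y)) = -entropy f := by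
      simp only [← sum_mul, hf, entropy, neg_neg, Fintype.sum_prod_type]
    have h4 : ∑ x, ∑ y, ∑ z, p (x, y, z) * Real.log (g (y, z)) = -entropy g := by
      rw [sum_comm]
      simp only [entropy, neg_neg, Fintype.sum_prod_type]
      refine sum_congr rfl fun y _ => ?_
      rw [sum_comm]
      simp only [← sum_mul, hg]
    have h5 : ∑ x, ∑ y, ∑ z, p (x, y, z) * Real.log (h y) = -entropy h := by
      rw [sum_comm]
      simp only [← sum_mul, hf, hfh, entropy, neg_neg]
    have h6 : ∑ x, ∑ y, ∑ z, p (x, y, z) * Real.log (p (x, y, z)) = -entropy p := by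
      simp only [entropy, neg_neg, Fintype.sum_prod_type]
    simp only [ht, mul_add, mul_sub, sum_add_distrib, sum_sub_distrib, h1, h2, h3, h4, h5, h6]
    linarith
  have hnn := fun x y z => (hkey x y z).1
  refine (hkey x y z).2 ?_
  have e1 := (sum_eq_zero_iff_of_nonneg fun x _ =>
    sum_nonneg fun y _ => sum_nonneg fun z _ => hnn x y z).1 hsum x (mem_univ x)
  have e2 := (sum_eq_zero_iff_of_nonneg fun y _ =>
    sum_nonneg fun z _ => hnn x y z).1 e1 y (mem_univ y)
  exact (sum_eq_zero_iff_of_nonneg fun z _ => hnn x y z).1 e2 z (mem_univ z)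

end Chain

section Cluster

variable {S : Type*} [Fintype S] {P : S × S × S × S → ℝ}

theorem sum_margAB_right (P : S × S × S × S → ℝ) (a : S) : ∑ b, margAB P (a, b) = margA P a := rfl

theorem sum_margAC_right (P : S × S × S × S → ℝ) (a : S) : ∑ c, margAC P (a, c) = margA P a :=
  sum_comm

theorem CL.sum_margAC_left (h : CL P) (c : S) : ∑ a, margAC P (a, c) = margA P c := by
  rw [← sum_margAB_right, h.1]
  simp only [margAC, margCD]
  rw [sum_comm_cycle]

theorem CL.sum_margAB_left (h : CL P) (b : S) : ∑ a, margAB P (a, b) = margA P b := by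
  rw [← sum_margAC_right, h.2]
  simp only [margAB, margBD]
  rw [sum_comm_cycle]

theorem sum_eq_of_CM_bottom_right (hP : ∀ x, 0 ≤ P x) (hL : CL P) (hM : CM P) (a c d : S) :
    ∑ b, P (a, b, c, d) = margAC P (a, c) * margAB P (c, d) / margA P c := by
  refine mul_eq_mul_of_entropy_eq (p := margACD P) (fun _ => sum_nonneg fun _ _ => hP _)
    (fun _ _ => sum_comm) (fun y z => ?_) hL.sum_margAC_left ?_ a c d
  · rw [hL.1]; rfl
  · linarith [hM.2]

theorem sum_eq_of_CM_top_left (hP : ∀ x, 0 ≤ P x) (hL : CL P) (hM : CM P) (a b d : S) :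
    ∑ c, P (a, b, c, d) = margAB P (a, b) * margAC P (b, d) / margA P b := by
  refine mul_eq_mul_of_entropy_eq (p := margABD P) (fun _ => sum_nonneg fun _ _ => hP _)
    (fun _ _ => sum_comm) (fun y z => ?_) hL.sum_margAB_left ?_ a b d
  · rw [hL.2]; rfl
  · linarith [hM.1]

/-- A cluster distribution viewed as an edge weight between its bottom and top rows. -/
def rowKernel (P : S × S × S × S → ℝ) (p : (S × S) × S × S) : ℝ :=
  P (p.1.1, p.1.2, p.2.1, p.2.2)

/-- The weight of two adjacent columns. -/
noncomputable def columnKernel (P : S × S × S × S → ℝ) (m : ℕ)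
    (p : (Fin (m + 2) → S) × (Fin (m + 2) → S)) : ℝ :=
  chainWeight (rowKernel P) (margAB P) m fun j => (p.1 j, p.2 j)

theorem sum_rowKernel_right (P : S × S × S × S → ℝ) (x : S × S) :
    ∑ y, rowKernel P (x, y) = margAB P x :=
  Fintype.sum_prod_type _

theorem CL.sum_rowKernel_left (h : CL P) (y : S × S) :
    ∑ x, rowKernel P (x, y) = margAB P y := by
  rw [h.1]
  exact Fintype.sum_prod_type _

theorem sum_columnKernel_right (hP : ∀ x, 0 ≤ P x) (hL : CL P) (hM : CM P) (m : ℕ)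
    (u : Fin (m + 2) → S) :
    ∑ v, columnKernel P m (u, v) = chainWeight (margAC P) (margA P) m u :=
  sum_chainWeight_snd (fun _ => hP _) (sum_rowKernel_right P) (fun _ _ => sum_comm)
    (sum_eq_of_CM_bottom_right hP hL hM) m u

theorem sum_columnKernel_left (hP : ∀ x, 0 ≤ P x) (hL : CL P) (hM : CM P) (m : ℕ)
    (v : Fin (m + 2) → S) :
    ∑ u, columnKernel P m (u, v) = chainWeight (margAC P) (margA P) m v := by
  have hrot := sum_chainWeight_snd
    (K := fun p => rowKernel P (p.2.swap, p.1.swap)) (r := fun x => margAB P x.swap)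
    (k := fun p => margAC P (p.2, p.1)) (ρ := margA P) (fun _ => hP _)
    (fun x => by
      rw [← hL.sum_rowKernel_left, ← Equiv.sum_comp (Equiv.prodComm S S)]; rfl)
    (fun a c => by rw [hL.2]; rfl)
    (fun a c d => by
      rw [mul_comm]; exact sum_eq_of_CM_top_left hP hL hM d c a) m (v ∘ Fin.rev)
  rw [← chainWeight_comp_rev] at hrot
  rw [← Equiv.sum_comp (Fin.revPerm.arrowCongr (Equiv.refl S))] at hrot
  have hv : (v ∘ Fin.rev) ∘ Fin.rev = v := by
    funext j; simp
  rw [hv] at hrot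
  rw [← hrot]
  refine sum_congr rfl fun u _ => ?_
  exact (chainWeight_comp_rev (fun p => rowKernel P (p.2.swap, p.1.swap))
    (fun x => margAB P x.swap) m fun j => (v j, u j)).symm

theorem entropy_columnKernel (hP : ∀ x, 0 ≤ P x) (hL : CL P) (m : ℕ) :
    entropy (columnKernel P m) = (m + 1) * entropy P - m * entropy (margAB P) := by
  have hrow : entropy (rowKernel P) = entropy P :=
    entropy_comp_equiv (Equiv.prodAssoc S S (S × S)) P
  rw [← hrow, ← entropy_chainWeight (K := rowKernel P) (fun _ => hP _) (sum_rowKernel_right P)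
    hL.sum_rowKernel_left]
  exact entropy_comp_equiv (Equiv.arrowProdEquivProdArrow (Fin (m + 2)) (fun _ => S)
    (fun _ => S)).symm (chainWeight (rowKernel P) (margAB P) m)

theorem QNM_eq_chainWeight [DecidableEq S] (P : S × S × S × S → ℝ) (n m : ℕ)
    (ω : Fin (n + 2) × Fin (m + 2) → S) :
    QNM P (n + 2) (m + 2) ω =
      chainWeight (columnKernel P m) (chainWeight (margAC P) (margA P) m) n
        (Function.curry ω) := by
  have hdiv : QNM P (n + 2) (m + 2) ω =
      QNMnum P (n + 2) (m + 2) ω / QNMden P (n + 2) (m + 2) ω := by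
    unfold QNM
    split_ifs with h
    · rw [h, zero_div]
    · rfl
  rw [hdiv]
  unfold columnKernel chainWeight
  simp only [prod_div_distrib]
  rw [div_div_div_eq, mul_comm (∏ i : Fin (n + 1), ∏ j : Fin m, _)]
  rfl

theorem entropy_QNM_eq [DecidableEq S] (P : S × S × S × S → ℝ) (n m : ℕ) :
    entropy (QNM P (n + 2) (m + 2)) =
      entropy (chainWeight (columnKernel P m) (chainWeight (margAC P) (margA P) m) n) := by
  rw [funext (QNM_eq_chainWeight P n m)]
  exact entropy_comp_equiv (Equiv.curry _ _ _) _

end Cluster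

/-- for `N, M ≥ 3`, the Shannon entropy of the explicitly constructed
distribution `Q_{N,M}` equals
`(N−1)(M−1)·H(P) + (N−2)(M−2)·H(P_a) − (N−2)(M−1)·H(P_ac) − (N−1)(M−2)·H(P_ab)`. -/
theorem entropy_QNM
    {S : Type*} [Fintype S] [DecidableEq S] [Nonempty S]
    (P : S × S × S × S → ℝ) (hP : IsProbDist P) (hCL : CL P) (hCM : CM P)
    (N M : ℕ) (hN : 3 ≤ N) (hM : 3 ≤ M) :
    entropy (QNM P N M) =
      ((N : ℝ) - 1) * ((M : ℝ) - 1) * entropy P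
        + ((N : ℝ) - 2) * ((M : ℝ) - 2) * entropy (margA P)
        - ((N : ℝ) - 2) * ((M : ℝ) - 1) * entropy (margAC P)
        - ((N : ℝ) - 1) * ((M : ℝ) - 2) * entropy (margAB P) := by
  obtain ⟨n, rfl⟩ : ∃ n, N = n + 2 := ⟨N - 2, by omega⟩
  obtain ⟨m, rfl⟩ : ∃ m, M = m + 2 := ⟨M - 2, by omega⟩
  have hAC : ∀ x, 0 ≤ margAC P x := fun _ => sum_nonneg fun _ _ => sum_nonneg fun _ _ => hP.1 _
  have hAB : ∀ x, 0 ≤ margAB P x := fun _ => sum_nonneg fun _ _ => sum_nonneg fun _ _ => hP.1 _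
  have hT : ∀ p, 0 ≤ columnKernel P m p := fun _ => chainWeight_nonneg (fun _ => hP.1 _) hAB _ _
  rw [entropy_QNM_eq, entropy_chainWeight hT (sum_columnKernel_right hP.1 hCL hCM m)
      (sum_columnKernel_left hP.1 hCL hCM m), entropy_columnKernel hP.1 hCL,
    entropy_chainWeight hAC (sum_margAC_right P) hCL.sum_margAC_left]
  push_cast
  ring
end

section
/- Let S be a nonempty finite set, let P be a probability distribution on S^4 satisfying the constraints C_L and C_M, and let N ≥ 3 and M ≥ 4 be integers. Then (row reduction): (i) summing Q_{N,M}(ω) over all values of the variables in the top row {ω(i,M) : 1 ≤ i ≤ N} yields Q_{N,M−1} evaluated on the restriction of ω to rows 1,…,M−1; and (ii) summing Q_{N,M}(ω) over all values of the variables in the bottom row {ω(i,1) : 1 ≤ i ≤ N} yields Q_{N,M−1} evaluated on the restriction of ω to rows 2,…,M (re-indexed as rows 1,…,M−1). -/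
open Finset

section Reduction

/-- Zero conditional mutual information of the outer coordinates given the middle one forces
the factorization `p(a,b,d) u(b) = q(a,b) t(b,d)`. -/
theorem mul_eq_mul_of_condMutualInfo_eq_zero {S : Type*} [Fintype S]
    {p : S × S × S → ℝ} {q t : S × S → ℝ} {u : S → ℝ} (hp : ∀ x, 0 ≤ p x)
    (hq : ∀ a b, q (a, b) = ∑ d, p (a, b, d))
    (ht : ∀ b d, t (b, d) = ∑ a, p (a, b, d))
    (hu : ∀ b, u b = ∑ a, ∑ d, p (a, b, d))
    (h : entropy q + entropy t - entropy u - entropy p = 0) (a b d : S) :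
    p (a, b, d) * u b = q (a, b) * t (b, d) := by
  have hq0 : ∀ a b, 0 ≤ q (a, b) := fun a b => hq a b ▸ sum_nonneg fun _ _ => hp _
  have ht0 : ∀ b d, 0 ≤ t (b, d) := fun b d => ht b d ▸ sum_nonneg fun _ _ => hp _
  have hu0 : ∀ b, 0 ≤ u b :=
    fun b => hu b ▸ sum_nonneg fun _ _ => sum_nonneg fun _ _ => hp _
  have hpq : ∀ a b d, p (a, b, d) ≤ q (a, b) := fun a b d => hq a b ▸
    single_le_sum (f := fun d => p (a, b, d)) (fun _ _ => hp _) (mem_univ d)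
  have hpt : ∀ a b d, p (a, b, d) ≤ t (b, d) := fun a b d => ht b d ▸
    single_le_sum (f := fun a => p (a, b, d)) (fun _ _ => hp _) (mem_univ a)
  have huq : ∀ b, u b = ∑ a, q (a, b) := fun b => by simp only [hu, hq]
  have hut : ∀ b, u b = ∑ d, t (b, d) := fun b => by
    simp only [hu, ht]; exact sum_comm
  have hqu : ∀ a b, q (a, b) ≤ u b := fun a b => huq b ▸
    single_le_sum (f := fun a => q (a, b)) (fun a _ => hq0 a b) (mem_univ a)
  let φ : S × S × S → ℝ := fun x =>
    p x * (Real.log (p x) + Real.log (u x.2.1) - Real.log (q (x.1, x.2.1)) - Real.log (t x.2))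
      - p x + q (x.1, x.2.1) * t x.2 / u x.2.1
  have pos : ∀ a b d, 0 < p (a, b, d) → 0 < q (a, b) ∧ 0 < t (b, d) ∧ 0 < u b := fun a b d h0 =>
    ⟨h0.trans_le (hpq a b d), h0.trans_le (hpt a b d),
      (h0.trans_le (hpq a b d)).trans_le (hqu a b)⟩
  have key : ∀ a b d, 0 < p (a, b, d) → φ (a, b, d) = p (a, b, d) *
      (q (a, b) * t (b, d) / (p (a, b, d) * u b) - 1
        - Real.log (q (a, b) * t (b, d) / (p (a, b, d) * u b))) := by
    intro a b d h0
    obtain ⟨h1, h2, h3⟩ := pos a b d h0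
    rw [Real.log_div (mul_pos h1 h2).ne' (mul_pos h0 h3).ne', Real.log_mul h1.ne' h2.ne',
      Real.log_mul h0.ne' h3.ne']
    simp only [φ]
    field_simp
    ring
  have hφ0 : ∀ x, 0 ≤ φ x := by
    rintro ⟨a, b, d⟩
    rcases (hp (a, b, d)).eq_or_lt with h0 | h0
    · simp only [φ, ← h0]
      simpa using div_nonneg (mul_nonneg (hq0 a b) (ht0 b d)) (hu0 b)
    · obtain ⟨h1, h2, h3⟩ := pos a b d h0
      rw [key a b d h0]
      have := Real.log_le_sub_one_of_pos (div_pos (mul_pos h1 h2) (mul_pos h0 h3))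
      exact mul_nonneg h0.le (by linarith)
  have hlogu : ∑ x, p x * Real.log (u x.2.1) = ∑ b, u b * Real.log (u b) := by
    simp only [Fintype.sum_prod_type]
    rw [sum_comm]
    refine sum_congr rfl fun b _ => ?_
    conv_rhs => rw [hu b, sum_mul]
    exact sum_congr rfl fun a _ => by rw [sum_mul, ← hu b]
  have hlogq : ∑ x, p x * Real.log (q (x.1, x.2.1)) = ∑ y, q y * Real.log (q y) := by
    simp only [Fintype.sum_prod_type]
    refine sum_congr rfl fun a _ => sum_congr rfl fun b _ => ?_
    rw [← sum_mul, ← hq]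
  have hlogt : ∑ x, p x * Real.log (t x.2) = ∑ y, t y * Real.log (t y) := by
    rw [Fintype.sum_prod_type, sum_comm]
    refine sum_congr rfl fun ⟨b, d⟩ _ => ?_
    conv_rhs => rw [ht b d, sum_mul, ← ht b d]
  have hprod : ∑ x : S × S × S, q (x.1, x.2.1) * t x.2 / u x.2.1 = ∑ x, p x := by
    simp only [Fintype.sum_prod_type]
    rw [sum_comm]
    conv_rhs => rw [sum_comm]
    refine sum_congr rfl fun b _ => ?_
    rw [← hu b]
    simp only [← sum_div, ← mul_sum, ← sum_mul]
    rw [← hut, ← huq, mul_self_div_self]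
  have hφ : ∑ x, φ x = 0 := by
    simp only [φ, sum_add_distrib, sum_sub_distrib, mul_add, mul_sub, hlogu, hlogq, hlogt, hprod]
    simp only [entropy] at h
    linarith
  have hz : φ (a, b, d) = 0 :=
    (sum_eq_zero_iff_of_nonneg fun x _ => hφ0 x).1 hφ _ (mem_univ _)
  rcases (hp (a, b, d)).eq_or_lt with h0 | h0
  · have hz' : q (a, b) * t (b, d) / u b = 0 := by simpa [φ, ← h0] using hz
    rw [← h0, zero_mul]
    rcases div_eq_zero_iff.1 hz' with h1 | h1
    · exact h1.symm
    · rw [le_antisymm ((hqu a b).trans h1.le) (hq0 a b), zero_mul]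
  · obtain ⟨h1, h2, h3⟩ := pos a b d h0
    rw [key a b d h0] at hz
    by_contra hne
    have := Real.log_lt_sub_one_of_pos (div_pos (mul_pos h1 h2) (mul_pos h0 h3))
      fun he => hne ((div_eq_one_iff_eq (mul_pos h0 h3).ne').1 he).symm
    exact (mul_pos h0 (sub_pos.2 this)).ne' hz

/-- Summing a chain of transfer weights from the left. -/
theorem sum_chain_eq_sum_last {S : Type*} [Fintype S] (n : ℕ) (f : Fin (n + 1) → S → S → ℝ)
    (g : Fin n → S → ℝ)
    (h : ∀ (i : Fin n) s s', (∑ x, f i.castSucc x s) * g i s * f i.succ s s' = f i.succ s s') :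
    ∑ r : Fin (n + 2) → S, (∏ i : Fin (n + 1), f i (r i.castSucc) (r i.succ)) *
      ∏ i : Fin n, g i (r i.castSucc.succ) = ∑ s, ∑ s', f (Fin.last n) s s' := by
  induction n with
  | zero =>
    rw [← (Fin.consEquiv fun _ : Fin 2 => S).sum_comp, Fintype.sum_prod_type]
    refine sum_congr rfl fun s _ => ?_
    rw [← (Equiv.funUnique (Fin 1) S).symm.sum_comp]
    refine sum_congr rfl fun s' _ => ?_
    simp [Fin.consEquiv]
  | succ n ih =>
    rw [← Fin.succ_last, ← ih (fun i => f i.succ) (fun i => g i.succ) fun i => h i.succ,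
      ← (Fin.consEquiv fun _ : Fin (n + 3) => S).sum_comp, Fintype.sum_prod_type, sum_comm]
    refine sum_congr rfl fun r _ => ?_
    simp only [Fin.consEquiv, Equiv.coe_fn_mk]
    have e := h 0 (r 0) (r (Fin.succ 0))
    simp only [Fin.castSucc_zero] at e
    calc _ = (∑ x, f 0 x (r 0)) * g 0 (r 0) * f (Fin.succ 0) (r 0) (r (Fin.succ 0)) *
          (∏ i : Fin n, f i.succ.succ (r i.succ.castSucc) (r i.succ.succ)) *
            ∏ i : Fin n, g i.succ (r i.castSucc.succ) := by
          simp only [sum_mul]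
          refine sum_congr rfl fun x _ => ?_
          rw [Fin.prod_univ_succ, Fin.prod_univ_succ (n := n), Fin.prod_univ_succ (n := n)]
          simp only [Fin.castSucc_zero, Fin.cons_zero, Fin.cons_succ, ← Fin.succ_castSucc]
          ring
      _ = _ := by
          rw [e, Fin.prod_univ_succ (n := n)]
          simp only [Fin.castSucc_zero, Fin.succ_castSucc]

/-- Summing a chain of transfer weights from the right. -/
theorem sum_chain_eq_sum_zero {S : Type*} [Fintype S] (n : ℕ) (f : Fin (n + 1) → S → S → ℝ)
    (g : Fin n → S → ℝ)
    (h : ∀ (i : Fin n) s s',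
      f i.castSucc s s' * g i s' * (∑ x, f i.succ s' x) = f i.castSucc s s') :
    ∑ r : Fin (n + 2) → S, (∏ i : Fin (n + 1), f i (r i.castSucc) (r i.succ)) *
      ∏ i : Fin n, g i (r i.castSucc.succ) = ∑ s, ∑ s', f 0 s s' := by
  have := sum_chain_eq_sum_last n (fun i s s' => f i.rev s' s) (fun i s => g i.rev s)
    fun i s s' => by
      rw [Fin.rev_castSucc, Fin.rev_succ]
      linarith [h i.rev s' s]
  rw [Fin.rev_last, sum_comm] at this
  rw [← this, ← (Equiv.arrowCongr Fin.revPerm (Equiv.refl S)).sum_comp]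
  refine sum_congr rfl fun r _ => ?_
  rw [← Equiv.prod_comp Fin.revPerm, ← Equiv.prod_comp (Fin.revPerm (n := n))]
  simp [Fin.rev_castSucc, Fin.rev_succ]

variable {S : Type*} [Fintype S]

section Marginals

variable {P : S × S × S × S → ℝ}

theorem margAB_ne_zero_of_ne_zero (h0 : ∀ x, 0 ≤ P x) {a b c d : S} (h : P (a, b, c, d) ≠ 0) :
    margAB P (a, b) ≠ 0 := fun hz => h <| by
  rw [margAB, sum_eq_zero_iff_of_nonneg fun _ _ => sum_nonneg fun _ _ => h0 _] at hz
  exact (sum_eq_zero_iff_of_nonneg fun _ _ => h0 _).1 (hz c (mem_univ c)) d (mem_univ d)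

theorem margCD_ne_zero_of_ne_zero (h0 : ∀ x, 0 ≤ P x) {a b c d : S} (h : P (a, b, c, d) ≠ 0) :
    margCD P (c, d) ≠ 0 := fun hz => h <| by
  rw [margCD, sum_eq_zero_iff_of_nonneg fun _ _ => sum_nonneg fun _ _ => h0 _] at hz
  exact (sum_eq_zero_iff_of_nonneg fun _ _ => h0 _).1 (hz a (mem_univ a)) b (mem_univ b)

theorem margAC_ne_zero_of_ne_zero (h0 : ∀ x, 0 ≤ P x) {a b c d : S} (h : P (a, b, c, d) ≠ 0) :
    margAC P (a, c) ≠ 0 := fun hz => h <| by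
  rw [margAC, sum_eq_zero_iff_of_nonneg fun _ _ => sum_nonneg fun _ _ => h0 _] at hz
  exact (sum_eq_zero_iff_of_nonneg fun _ _ => h0 _).1 (hz b (mem_univ b)) d (mem_univ d)

theorem margBD_ne_zero_of_ne_zero (h0 : ∀ x, 0 ≤ P x) {a b c d : S} (h : P (a, b, c, d) ≠ 0) :
    margBD P (b, d) ≠ 0 := fun hz => h <| by
  rw [margBD, sum_eq_zero_iff_of_nonneg fun _ _ => sum_nonneg fun _ _ => h0 _] at hz
  exact (sum_eq_zero_iff_of_nonneg fun _ _ => h0 _).1 (hz a (mem_univ a)) c (mem_univ c)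

theorem margA_eq_sum_margAB (a : S) : margA P a = ∑ b, margAB P (a, b) := rfl

theorem margA_eq_sum_margAC (a : S) : margA P a = ∑ c, margAC P (a, c) := by
  simp only [margA, margAC]
  exact sum_comm

theorem margA_ne_zero_of_margAB_ne_zero (h0 : ∀ x, 0 ≤ P x) {a b : S}
    (h : margAB P (a, b) ≠ 0) : margA P a ≠ 0 := fun hz => h <| by
  rw [margA, sum_eq_zero_iff_of_nonneg fun _ _ =>
    sum_nonneg fun _ _ => sum_nonneg fun _ _ => h0 _] at hz
  exact hz b (mem_univ b)

theorem margABD_mul_margA (h0 : ∀ x, 0 ≤ P x) (hCL : CL P) (hCM : CM P) (a b d : S) :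
    margABD P (a, b, d) * margA P b = margAB P (a, b) * margAC P (b, d) := by
  refine mul_eq_mul_of_condMutualInfo_eq_zero (p := margABD P)
    (fun _ => sum_nonneg fun _ _ => h0 _) (fun a b => ?_) (fun b d => ?_) (fun b => ?_) ?_ a b d
  · exact sum_comm
  · rw [hCL.2]; rfl
  · rw [margA_eq_sum_margAC, hCL.2, sum_comm]; rfl
  · linarith [hCM.1]

theorem margACD_mul_margA (h0 : ∀ x, 0 ≤ P x) (hCL : CL P) (hCM : CM P) (a c d : S) :
    margACD P (a, c, d) * margA P c = margAC P (a, c) * margAB P (c, d) := by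
  refine mul_eq_mul_of_condMutualInfo_eq_zero (p := margACD P)
    (fun _ => sum_nonneg fun _ _ => h0 _) (fun a c => ?_) (fun c d => ?_) (fun c => ?_) ?_ a c d
  · exact sum_comm
  · rw [hCL.1]; rfl
  · rw [margA_eq_sum_margAB, hCL.1, sum_comm]; rfl
  · linarith [hCM.2]

/-- The conditional weight of a row placed above the row `y` sums to one. -/
theorem sum_row_above (h0 : ∀ x, 0 ≤ P x) (hCL : CL P) (hCM : CM P) (n : ℕ)
    (y : Fin (n + 2) → S) (hy : ∀ i : Fin (n + 1), margAB P (y i.castSucc, y i.succ) ≠ 0) :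
    ∑ r : Fin (n + 2) → S,
      (∏ i : Fin (n + 1), P (y i.castSucc, y i.succ, r i.castSucc, r i.succ) /
        margAB P (y i.castSucc, y i.succ)) *
      ∏ i : Fin n, margA P (y i.castSucc.succ) /
        margAC P (y i.castSucc.succ, r i.castSucc.succ) = 1 := by
  refine (sum_chain_eq_sum_last n
    (fun i s s' => P (y i.castSucc, y i.succ, s, s') / margAB P (y i.castSucc, y i.succ))
    (fun i s => margA P (y i.castSucc.succ) / margAC P (y i.castSucc.succ, s))
    fun i s s' => ?_).trans ?_
  · by_cases hP : P (y i.succ.castSucc, y i.succ.succ, s, s') = 0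
    · simp only [hP, zero_div, mul_zero]
    have hA := margA_ne_zero_of_margAB_ne_zero h0 (hy i.succ)
    have hAC := margAC_ne_zero_of_ne_zero h0 hP
    have hAB := hy i.castSucc
    have e := margABD_mul_margA h0 hCL hCM (y i.castSucc.castSucc) (y i.castSucc.succ) s
    rw [← Fin.succ_castSucc] at hA hAC
    rw [← sum_div]
    change margABD P (y i.castSucc.castSucc, y i.castSucc.succ, s) / _ * _ * _ = _
    rw [div_mul_div_comm, e, div_self (mul_ne_zero hAB hAC), one_mul]
  · simp only [← sum_div]
    exact div_self (hy (Fin.last n))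

/-- The conditional weight of a row placed below the row `y` sums to one. -/
theorem sum_row_below (h0 : ∀ x, 0 ≤ P x) (hCL : CL P) (hCM : CM P) (n : ℕ)
    (y : Fin (n + 2) → S) (hy : ∀ i : Fin (n + 1), margAB P (y i.castSucc, y i.succ) ≠ 0) :
    ∑ r : Fin (n + 2) → S,
      (∏ i : Fin (n + 1), P (r i.castSucc, r i.succ, y i.castSucc, y i.succ) /
        margAB P (y i.castSucc, y i.succ)) *
      ∏ i : Fin n, margA P (y i.castSucc.succ) /
        margAC P (r i.castSucc.succ, y i.castSucc.succ) = 1 := by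
  refine (sum_chain_eq_sum_zero n
    (fun i s s' => P (s, s', y i.castSucc, y i.succ) / margAB P (y i.castSucc, y i.succ))
    (fun i s => margA P (y i.castSucc.succ) / margAC P (s, y i.castSucc.succ))
    fun i s s' => ?_).trans ?_
  · by_cases hP : P (s, s', y i.castSucc.castSucc, y i.castSucc.succ) = 0
    · simp only [hP, zero_div, zero_mul]
    have hA := margA_ne_zero_of_margAB_ne_zero h0 (hy i.succ)
    have hAC := margBD_ne_zero_of_ne_zero h0 hP
    have hAB := hy i.succ
    have e := margACD_mul_margA h0 hCL hCM s' (y i.succ.castSucc) (y i.succ.succ)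
    rw [← hCL.2, Fin.succ_castSucc] at hAC
    rw [← sum_div]
    change _ * _ * (margACD P (s', y i.succ.castSucc, y i.succ.succ) / _) = _
    rw [mul_assoc, Fin.succ_castSucc, div_mul_div_comm, mul_comm (margA P _), e,
      div_self (mul_ne_zero hAC hAB), mul_one]
  · simp only [← sum_div]
    change margCD P (y (Fin.castSucc 0), y (Fin.succ 0)) / _ = 1
    rw [← hCL.1]
    exact div_self (hy 0)

end Marginals

variable (P : S × S × S × S → ℝ)

theorem QNM_eq_div (N M : ℕ) (ω : Fin N × Fin M → S) :
    QNM P N M ω = QNMnum P N M ω / QNMden P N M ω := by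
  unfold QNM
  split_ifs with h
  · rw [h, zero_div]
  · rfl

theorem QNM_ne_zero_cluster {P : S × S × S × S → ℝ} {N M : ℕ} {ω : Fin N × Fin M → S}
    (h : QNM P N M ω ≠ 0) (i : Fin (N - 1)) (j : Fin (M - 1)) : P (cluster ω i j) ≠ 0 := by
  intro hz
  apply h
  have : QNMnum P N M ω = 0 := by
    rw [QNMnum, prod_eq_zero (mem_univ i) (prod_eq_zero (mem_univ j) hz), zero_mul]
  rw [QNM_eq_div, this, zero_div]

/-- Adding a row on top multiplies the ansatz by the conditional weight of that row. -/
theorem QNM_add_row_above (n m : ℕ) (ω : Fin (n + 2) × Fin (m + 3) → S)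
    (ω' : Fin (n + 2) × Fin (m + 2) → S) (hω : ∀ i j, ω (i, Fin.castSucc j) = ω' (i, j)) :
    QNM P (n + 2) (m + 3) ω = QNM P (n + 2) (m + 2) ω' *
      ((∏ i : Fin (n + 1), P (ω' (i.castSucc, Fin.last _), ω' (i.succ, Fin.last _),
          ω (i.castSucc, Fin.last _), ω (i.succ, Fin.last _)) /
        margAB P (ω' (i.castSucc, Fin.last _), ω' (i.succ, Fin.last _))) *
      ∏ i : Fin n, margA P (ω' (i.castSucc.succ, Fin.last _)) /
        margAC P (ω' (i.castSucc.succ, Fin.last _), ω (i.castSucc.succ, Fin.last _))) := by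
  obtain rfl : (fun p => ω (p.1, Fin.castSucc p.2)) = ω' := funext fun p => hω p.1 p.2
  rw [QNM_eq_div, QNM_eq_div]
  have e1 : QNMnum P (n + 2) (m + 3) ω = QNMnum P (n + 2) (m + 2)
      (fun p => ω (p.1, Fin.castSucc p.2)) *
      ((∏ i : Fin (n + 1), P (ω (i.castSucc, (Fin.last _).castSucc),
          ω (i.succ, (Fin.last _).castSucc),
          ω (i.castSucc, Fin.last _), ω (i.succ, Fin.last _))) *
        ∏ i : Fin n, margA P (ω (i.castSucc.succ, (Fin.last _).castSucc))) := by
    have h1 : ∀ i : Fin (n + 1), ∏ j : Fin (m + 2), P (cluster ω i j) = _ :=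
      fun i => Fin.prod_univ_castSucc _
    have h2 : ∀ i : Fin n, ∏ j : Fin (m + 1), margA P (ω (i.castSucc.succ, j.succ.castSucc)) = _ :=
      fun i => Fin.prod_univ_castSucc _
    refine (congrArg₂ (· * ·) (prod_congr rfl fun i _ => h1 i)
      (prod_congr rfl fun i _ => h2 i)).trans ?_
    rw [prod_mul_distrib, prod_mul_distrib]
    exact mul_mul_mul_comm _ _ _ _
  have e2 : QNMden P (n + 2) (m + 3) ω = QNMden P (n + 2) (m + 2)
      (fun p => ω (p.1, Fin.castSucc p.2)) *
      ((∏ i : Fin n, margAC P (ω (i.castSucc.succ, (Fin.last _).castSucc),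
          ω (i.castSucc.succ, Fin.last _))) *
        ∏ i : Fin (n + 1), margAB P (ω (i.castSucc, (Fin.last _).castSucc),
          ω (i.succ, (Fin.last _).castSucc))) := by
    have h1 : ∀ i : Fin n, ∏ j : Fin (m + 2), margAC P (ω (i.castSucc.succ, j.castSucc),
        ω (i.castSucc.succ, j.succ)) = _ :=
      fun i => Fin.prod_univ_castSucc _
    have h2 : ∀ i : Fin (n + 1), ∏ j : Fin (m + 1), margAB P (ω (i.castSucc, j.succ.castSucc),
        ω (i.succ, j.succ.castSucc)) = _ :=
      fun i => Fin.prod_univ_castSucc _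
    refine (congrArg₂ (· * ·) (prod_congr rfl fun i _ => h1 i)
      (prod_congr rfl fun i _ => h2 i)).trans ?_
    rw [prod_mul_distrib, prod_mul_distrib]
    exact mul_mul_mul_comm _ _ _ _
  rw [e1, e2, prod_div_distrib, prod_div_distrib, mul_comm (∏ i : Fin n, margAC P _),
    mul_div_mul_comm]
  exact congrArg _ (mul_div_mul_comm _ _ _ _)

/-- Adding a row at the bottom multiplies the ansatz by the conditional weight of that row. -/
theorem QNM_add_row_below (n m : ℕ) (ω : Fin (n + 2) × Fin (m + 3) → S)
    (ω' : Fin (n + 2) × Fin (m + 2) → S) (hω : ∀ i j, ω (i, Fin.succ j) = ω' (i, j)) :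
    QNM P (n + 2) (m + 3) ω = QNM P (n + 2) (m + 2) ω' *
      ((∏ i : Fin (n + 1), P (ω (i.castSucc, 0), ω (i.succ, 0),
          ω' (i.castSucc, 0), ω' (i.succ, 0)) /
        margAB P (ω' (i.castSucc, 0), ω' (i.succ, 0))) *
      ∏ i : Fin n, margA P (ω' (i.castSucc.succ, 0)) /
        margAC P (ω (i.castSucc.succ, 0), ω' (i.castSucc.succ, 0))) := by
  obtain rfl : (fun p => ω (p.1, Fin.succ p.2)) = ω' := funext fun p => hω p.1 p.2
  rw [QNM_eq_div, QNM_eq_div]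
  have e1 : QNMnum P (n + 2) (m + 3) ω = QNMnum P (n + 2) (m + 2)
      (fun p => ω (p.1, Fin.succ p.2)) *
      ((∏ i : Fin (n + 1), P (ω (i.castSucc, 0), ω (i.succ, 0),
          ω (i.castSucc, Fin.succ 0), ω (i.succ, Fin.succ 0))) *
        ∏ i : Fin n, margA P (ω (i.castSucc.succ, Fin.succ 0))) := by
    have h1 : ∀ i : Fin (n + 1), ∏ j : Fin (m + 2), P (cluster ω i j) = _ :=
      fun i => Fin.prod_univ_succ _
    have h2 : ∀ i : Fin n, ∏ j : Fin (m + 1), margA P (ω (i.castSucc.succ, j.castSucc.succ)) = _ :=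
      fun i => Fin.prod_univ_succ _
    refine (congrArg₂ (· * ·) (prod_congr rfl fun i _ => h1 i)
      (prod_congr rfl fun i _ => h2 i)).trans ?_
    rw [prod_mul_distrib, prod_mul_distrib]
    exact (mul_mul_mul_comm _ _ _ _).trans (mul_comm _ _)
  have e2 : QNMden P (n + 2) (m + 3) ω = QNMden P (n + 2) (m + 2)
      (fun p => ω (p.1, Fin.succ p.2)) *
      ((∏ i : Fin n, margAC P (ω (i.castSucc.succ, 0), ω (i.castSucc.succ, Fin.succ 0))) *
        ∏ i : Fin (n + 1), margAB P (ω (i.castSucc, Fin.succ 0), ω (i.succ, Fin.succ 0))) := by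
    have h1 : ∀ i : Fin n, ∏ j : Fin (m + 2), margAC P (ω (i.castSucc.succ, j.castSucc),
        ω (i.castSucc.succ, j.succ)) = _ :=
      fun i => Fin.prod_univ_succ _
    have h2 : ∀ i : Fin (n + 1), ∏ j : Fin (m + 1), margAB P (ω (i.castSucc, j.castSucc.succ),
        ω (i.succ, j.castSucc.succ)) = _ :=
      fun i => Fin.prod_univ_succ _
    refine (congrArg₂ (· * ·) (prod_congr rfl fun i _ => h1 i)
      (prod_congr rfl fun i _ => h2 i)).trans ?_
    rw [prod_mul_distrib, prod_mul_distrib]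
    exact (mul_mul_mul_comm _ _ _ _).trans (mul_comm _ _)
  rw [e1, e2, prod_div_distrib, prod_div_distrib, mul_comm (∏ i : Fin n, margAC P _),
    mul_div_mul_comm]
  exact congrArg _ (mul_div_mul_comm _ _ _ _)

end Reduction

/-- row reduction, Theorem 3 of the paper: for `N ≥ 3`, `M ≥ 4`, summing
`Q_{N,M}` over the top (resp. bottom) row yields `Q_{N,M−1}` on the remaining rows. -/
theorem QNM_row_reduction
    {S : Type*} [Fintype S] [DecidableEq S] [Nonempty S]
    (P : S × S × S × S → ℝ) (hP : IsProbDist P) (hCL : CL P) (hCM : CM P)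
    (N M : ℕ) (hN : 3 ≤ N) (hM : 4 ≤ M) (ω' : Fin N × Fin (M - 1) → S) :
    -- (i) summing over the top row (row `M`, the rest being rows `1, …, M−1` of `ω'`)
    (∑ r : Fin N → S,
      QNM P N M (fun p => if h : p.2.1 < M - 1 then ω' (p.1, ⟨p.2.1, h⟩) else r p.1))
      = QNM P N (M - 1) ω' ∧
    -- (ii) summing over the bottom row (row `1`, the rest being rows `2, …, M`,
    -- re-indexed as rows `1, …, M−1` of `ω'`)
    (∑ r : Fin N → S,
      QNM P N M (fun p =>
        if h : p.2.1 = 0 then r p.1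
        else ω' (p.1, ⟨p.2.1 - 1, by have := p.2.isLt; omega⟩)))
      = QNM P N (M - 1) ω' := by
  obtain ⟨n, rfl⟩ : ∃ n, N = n + 2 := ⟨N - 2, by omega⟩
  obtain ⟨m, rfl⟩ : ∃ m, M = m + 3 := ⟨M - 3, by omega⟩
  change Fin (n + 2) × Fin (m + 2) → S at ω'
  constructor
  · rw [sum_congr rfl fun r _ => QNM_add_row_above P n m _ ω' fun i j => dif_pos j.isLt, ← mul_sum]
    by_cases hQ : QNM P (n + 2) (m + 2) ω' = 0
    · rw [hQ, zero_mul]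
      exact hQ.symm
    have := sum_row_above hP.1 hCL hCM n (fun i => ω' (i, Fin.last _)) fun i => by
      rw [hCL.1]
      exact margCD_ne_zero_of_ne_zero hP.1 (QNM_ne_zero_cluster hQ i (Fin.last m))
    simp only [Fin.val_last, Nat.add_one_sub_one, lt_self_iff_false, dite_false]
    refine (congrArg _ this).trans (mul_one _)
  · rw [sum_congr rfl fun r _ => QNM_add_row_below P n m _ ω' fun i j => dif_neg (by simp),
      ← mul_sum]
    by_cases hQ : QNM P (n + 2) (m + 2) ω' = 0
    · rw [hQ, zero_mul]
      exact hQ.symm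
    have := sum_row_below hP.1 hCL hCM n (fun i => ω' (i, 0)) fun i =>
      margAB_ne_zero_of_ne_zero hP.1 (QNM_ne_zero_cluster hQ i (0 : Fin (m + 1)))
    refine (congrArg _ this).trans (mul_one _)
end
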